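/- For every natural number q ≥ 10, ∑_{x=0}^{q} ∑_{y=0}^{C(q,2)} ∑_{z=0}^{x+y−1} C(q,x)·C(C(q,2),y)·C(C(q,3),z) ≤ 2^{q + C(q,2) + C(q,3)·H((q + C(q,2))/C(q,3))}, where C(n,k) denotes the binomial coefficient (with C(n,k) = 0 for k > n). -/

import Mathlib

/-- The binary entropy function `H(u) = −u·log₂ u − (1−u)·log₂(1−u)`
(with the conventions `H(0) = H(1) = 0`, using `Real.logb 2 0 = 0`). -/
noncomputable def binaryEntropy (u : ℝ) : ℝ :=
  -u * Real.logb 2 u - (1 - u) * Real.logb 2 (1 - u)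

lemma two_rpow_mul_binaryEntropy {n k : ℕ} (hk : 0 < k) (hkn : k < n) :
    (2 : ℝ) ^ ((n : ℝ) * binaryEntropy ((k : ℝ) / n)) =
      (((k : ℝ) / n) ^ k * (1 - (k : ℝ) / n) ^ (n - k))⁻¹ := by
  have hn : (0 : ℝ) < n := by exact_mod_cast hk.trans hkn
  have hp : (0 : ℝ) < (k : ℝ) / n := div_pos (by exact_mod_cast hk) hn
  have hp1 : (0 : ℝ) < 1 - (k : ℝ) / n := by
    rw [sub_pos, div_lt_one hn]
    exact_mod_cast hkn
  have hexp : (n : ℝ) * binaryEntropy ((k : ℝ) / n) =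
      -Real.logb 2 (((k : ℝ) / n) ^ k * (1 - (k : ℝ) / n) ^ (n - k)) := by
    rw [Real.logb_mul (by positivity) (by positivity), Real.logb_pow, Real.logb_pow,
      Nat.cast_sub hkn.le, binaryEntropy]
    generalize Real.logb 2 ((k : ℝ) / n) = a
    generalize Real.logb 2 (1 - (k : ℝ) / n) = b
    field_simp
    ring
  rw [hexp, Real.rpow_neg (by norm_num), Real.rpow_logb (by norm_num) (by norm_num)
    (by positivity)]

/-- The volume of a Hamming ball of radius `k ≤ n / 2` is at most `2 ^ (n * H (k / n))`. -/
lemma sum_range_choose_le_two_rpow {n k : ℕ} (hk : 0 < k) (hkn : 2 * k ≤ n) :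
    ∑ z ∈ Finset.range (k + 1), (n.choose z : ℝ) ≤
      (2 : ℝ) ^ ((n : ℝ) * binaryEntropy ((k : ℝ) / n)) := by
  have hlt : k < n := by omega
  rw [two_rpow_mul_binaryEntropy hk hlt]
  have hn : (0 : ℝ) < n := by exact_mod_cast hk.trans hlt
  have hkn' : 2 * (k : ℝ) ≤ n := by exact_mod_cast hkn
  have hp : (0 : ℝ) < (k : ℝ) / n := div_pos (by exact_mod_cast hk) hn
  have hle : (k : ℝ) / n ≤ 1 - (k : ℝ) / n := by
    have : (k : ℝ) / n ≤ 1 / 2 := by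
      rw [div_le_iff₀ hn]
      linarith
    linarith
  generalize (k : ℝ) / n = p at hp hle
  have hp1 : 0 < 1 - p := hp.trans_le hle
  rw [← one_div, le_div_iff₀ (by positivity), Finset.sum_mul]
  calc ∑ z ∈ Finset.range (k + 1), (n.choose z : ℝ) * (p ^ k * (1 - p) ^ (n - k))
      ≤ ∑ z ∈ Finset.range (k + 1), p ^ z * (1 - p) ^ (n - z) * (n.choose z : ℝ) := by
        refine Finset.sum_le_sum fun z hz => ?_
        have hz : z ≤ k := Nat.lt_succ_iff.mp (Finset.mem_range.mp hz)
        rw [mul_comm]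
        refine mul_le_mul_of_nonneg_right ?_ (Nat.cast_nonneg _)
        calc p ^ k * (1 - p) ^ (n - k) = p ^ z * p ^ (k - z) * (1 - p) ^ (n - k) := by
              rw [← pow_add, Nat.add_sub_cancel' hz]
          _ ≤ p ^ z * (1 - p) ^ (k - z) * (1 - p) ^ (n - k) := by gcongr
          _ = p ^ z * (1 - p) ^ (n - z) := by
              rw [mul_assoc, ← pow_add]
              congr 2
              omega
    _ ≤ ∑ z ∈ Finset.range (n + 1), p ^ z * (1 - p) ^ (n - z) * (n.choose z : ℝ) :=
        Finset.sum_le_sum_of_subset_of_nonneg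
          (Finset.range_subset_range.mpr (by omega)) fun _ _ _ => by positivity
    _ = 1 := by rw [← add_pow, add_sub_cancel, one_pow]

lemma two_mul_add_choose_two_le_choose_three {q : ℕ} (hq : 10 ≤ q) :
    2 * (q + q.choose 2) ≤ q.choose 3 := by
  obtain ⟨t, rfl⟩ := Nat.exists_eq_add_of_le' hq
  have h2 := Nat.choose_succ_right_eq (t + 10) 1
  have h3 := Nat.choose_succ_right_eq (t + 10) 2
  simp only [Nat.choose_one_right, show t + 10 - 1 = t + 9 by omega,
    show t + 10 - 2 = t + 8 by omega, Nat.reduceAdd] at h2 h3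
  nlinarith

/-- Entropy bound on the number of `q`-qubit IQP circuits with `#CCZ < #Z + #CZ`: for
`q ≥ 10`,
`∑_{x=0}^{q} ∑_{y=0}^{C(q,2)} ∑_{z=0}^{x+y−1} C(q,x)·C(C(q,2),y)·C(C(q,3),z)
  ≤ 2^{q + C(q,2) + C(q,3)·H((q + C(q,2))/C(q,3))}`. -/
theorem card_complement_Pq_le (q : ℕ) (hq : 10 ≤ q) :
    ((∑ x ∈ Finset.range (q + 1), ∑ y ∈ Finset.range (q.choose 2 + 1),
        ∑ z ∈ Finset.range (x + y),
          q.choose x * (q.choose 2).choose y * (q.choose 3).choose z : ℕ) : ℝ)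
      ≤ (2 : ℝ) ^ ((q : ℝ) + (q.choose 2 : ℝ) + (q.choose 3 : ℝ) *
          binaryEntropy (((q : ℝ) + (q.choose 2 : ℝ)) / (q.choose 3 : ℝ))) := by
  set m := q.choose 2
  set n := q.choose 3
  have hball := sum_range_choose_le_two_rpow (n := n) (k := q + m) (by omega)
    (two_mul_add_choose_two_le_choose_three hq)
  have hcount : (∑ x ∈ Finset.range (q + 1), ∑ y ∈ Finset.range (m + 1),
      ∑ z ∈ Finset.range (x + y), q.choose x * m.choose y * n.choose z) ≤
      2 ^ q * 2 ^ m * ∑ z ∈ Finset.range (q + m + 1), n.choose z := by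
    rw [← Nat.sum_range_choose q, ← Nat.sum_range_choose m, Finset.sum_mul_sum, Finset.sum_mul]
    refine Finset.sum_le_sum fun x hx => ?_
    rw [Finset.sum_mul]
    refine Finset.sum_le_sum fun y hy => ?_
    rw [← Finset.mul_sum]
    rw [Finset.mem_range] at hx hy
    exact Nat.mul_le_mul_left _
      (Finset.sum_le_sum_of_subset (Finset.range_subset_range.mpr (by omega)))
  rw [Real.rpow_add (by norm_num), Real.rpow_add (by norm_num), Real.rpow_natCast,
    Real.rpow_natCast]
  push_cast at hball
  refine (Nat.cast_le.mpr hcount).trans ?_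
  push_cast
  gcongr
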